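/- arXiv:2212.08422 — 2 statements merged into one kernel-verified Lean document; each statement's English description precedes it below -/
import Mathlib

section
/- Let δ ≥ 1 and m ≥ δ+1 be integers and let 𝒯, 𝒯' be triangulations of the cyclic polytope C(m, δ). Then 𝒯 ≤₂ 𝒯' if and only if every (⌊δ/2⌋+1)-element subset A of {1, …, m} such that |A|_δ is supermerged by 𝒯' also has |A|_δ supermerged by 𝒯. -/
open Finset

noncomputable section

/-- The moment curve `p_δ(t) = (t, t², …, t^δ)` in `ℝ^δ`. -/
def momCurve (δ : ℕ) (t : ℝ) : Fin δ → ℝ := fun i => t ^ (i.1 + 1)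

/-- The points `p_δ(a)` on the moment curve for `a` ranging over a finite set of naturals. -/
def momPts (δ : ℕ) (A : Finset ℕ) : Set (Fin δ → ℝ) :=
  (fun a : ℕ => momCurve δ (a : ℝ)) '' (A : Set ℕ)

/-- The simplex `|A|_δ`, i.e. the convex hull of the points `p_δ(a)`, `a ∈ A`. -/
def smp (δ : ℕ) (A : Finset ℕ) : Set (Fin δ → ℝ) := convexHull ℝ (momPts δ A)

/-- The cyclic polytope `C(m, δ) = conv{p_δ(1), …, p_δ(m)}`. -/
def cyc (m δ : ℕ) : Set (Fin δ → ℝ) := smp δ (Finset.Icc 1 m)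

/-- The last standard basis vector `e_δ` of `ℝ^δ`. -/
def eLast (δ : ℕ) : Fin δ → ℝ := fun i => if i.1 = δ - 1 then 1 else 0

/-- The last coordinate of a point of `ℝ^δ`. -/
def lastCoord {δ : ℕ} (x : Fin δ → ℝ) : ℝ :=
  if h : 0 < δ then x ⟨δ - 1, Nat.sub_lt h one_pos⟩ else 0

/-- `x` lies strictly above `V`: `x - r • e_δ ∈ V` for some `r > 0`. -/
def StrictlyAbove {δ : ℕ} (x : Fin δ → ℝ) (V : Set (Fin δ → ℝ)) : Prop :=
  ∃ r : ℝ, 0 < r ∧ x - r • eLast δ ∈ V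

/-- `x` lies strictly below `V`: `x - r • e_δ ∈ V` for some `r < 0`. -/
def StrictlyBelow {δ : ℕ} (x : Fin δ → ℝ) (V : Set (Fin δ → ℝ)) : Prop :=
  ∃ r : ℝ, r < 0 ∧ x - r • eLast δ ∈ V

/-- `|F|_δ` is a lower facet of the cyclic polytope `C(m, δ)`. -/
def IsLowerFacet (m δ : ℕ) (F : Finset ℕ) : Prop :=
  F ⊆ Finset.Icc 1 m ∧ F.card = δ ∧
    ∀ i ∈ Finset.Icc 1 m, i ∉ F →
      StrictlyAbove (momCurve δ (i : ℝ))
        ((affineSpan ℝ (momPts δ F) : AffineSubspace ℝ (Fin δ → ℝ)) : Set (Fin δ → ℝ))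

/-- `|F|_δ` is an upper facet of the cyclic polytope `C(m, δ)`. -/
def IsUpperFacet (m δ : ℕ) (F : Finset ℕ) : Prop :=
  F ⊆ Finset.Icc 1 m ∧ F.card = δ ∧
    ∀ i ∈ Finset.Icc 1 m, i ∉ F →
      StrictlyBelow (momCurve δ (i : ℝ))
        ((affineSpan ℝ (momPts δ F) : AffineSubspace ℝ (Fin δ → ℝ)) : Set (Fin δ → ℝ))

/-- The facet `|H ∖ {c}|_δ` of the simplex `|H|_δ` is a lower facet of `|H|_δ`. -/
def IsLowerFacetOfSimplex (δ : ℕ) (H : Finset ℕ) (c : ℕ) : Prop :=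
  c ∈ H ∧ StrictlyAbove (momCurve δ (c : ℝ))
    ((affineSpan ℝ (momPts δ (H.erase c)) : AffineSubspace ℝ (Fin δ → ℝ)) : Set (Fin δ → ℝ))

/-- The facet `|H ∖ {c}|_δ` of the simplex `|H|_δ` is an upper facet of `|H|_δ`. -/
def IsUpperFacetOfSimplex (δ : ℕ) (H : Finset ℕ) (c : ℕ) : Prop :=
  c ∈ H ∧ StrictlyBelow (momCurve δ (c : ℝ))
    ((affineSpan ℝ (momPts δ (H.erase c)) : AffineSubspace ℝ (Fin δ → ℝ)) : Set (Fin δ → ℝ))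

/-- `T` is a triangulation of the cyclic polytope `C(m, δ)`. -/
def IsTriangulation (m δ : ℕ) (T : Finset (Finset ℕ)) : Prop :=
  (∀ S ∈ T, S ⊆ Finset.Icc 1 m ∧ S.card = δ + 1) ∧
  (⋃ S ∈ T, smp δ S) = cyc m δ ∧
  ∀ S ∈ T, ∀ S' ∈ T, smp δ S ∩ smp δ S' = smp δ (S ∩ S')

/-- `A` is a face of the triangulation `T`. -/
def IsFace (T : Finset (Finset ℕ)) (A : Finset ℕ) : Prop := ∃ S ∈ T, A ⊆ S

/-- `A ≀ B`: writing `A = {a_0 < … < a_d}` and `B = {b_0 < … < b_d}`, we have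
`a_0 < b_0 < a_1 < b_1 < … < a_d < b_d`. -/
def Intertwines (d : ℕ) (A B : Finset ℕ) : Prop :=
  ∃ a b : Fin (d + 1) → ℕ, StrictMono a ∧ StrictMono b ∧
    A = Finset.image a Finset.univ ∧ B = Finset.image b Finset.univ ∧
    (∀ i, a i < b i) ∧ ∀ i : Fin d, b i.castSucc < a i.succ

/-- `y = ℓ_S(x)` is the lift of `x ∈ |S|_δ` to `ℝ^{δ+1}` given by the barycentric
coordinates of `x` with respect to the vertices of `|S|_δ`. -/
def IsLift (δ : ℕ) (S : Finset ℕ) (x : Fin δ → ℝ) (y : Fin (δ + 1) → ℝ) : Prop :=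
  ∃ w : ℕ → ℝ, (∀ a ∈ S, 0 ≤ w a) ∧ (∑ a ∈ S, w a) = 1 ∧
    (∑ a ∈ S, w a • momCurve δ (a : ℝ)) = x ∧
    (∑ a ∈ S, w a • momCurve (δ + 1) (a : ℝ)) = y

/-- `|A|_δ` is submerged by the triangulation `T`. -/
def Submerged (δ : ℕ) (T : Finset (Finset ℕ)) (A : Finset ℕ) : Prop :=
  ∀ S ∈ T, ∀ x ∈ smp δ A ∩ smp δ S, ∀ y y' : Fin (δ + 1) → ℝ,
    IsLift δ A x y → IsLift δ S x y' → lastCoord y ≤ lastCoord y'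

/-- `|A|_δ` is supermerged by the triangulation `T`. -/
def Supermerged (δ : ℕ) (T : Finset (Finset ℕ)) (A : Finset ℕ) : Prop :=
  ∀ S ∈ T, ∀ x ∈ smp δ A ∩ smp δ S, ∀ y y' : Fin (δ + 1) → ℝ,
    IsLift δ A x y → IsLift δ S x y' → lastCoord y' ≤ lastCoord y

/-- The second higher Stasheff–Tamari order `T ≤₂ T'`. -/
def HST2 (δ : ℕ) (T T' : Finset (Finset ℕ)) : Prop :=
  ∀ S ∈ T, ∀ S' ∈ T', ∀ x ∈ smp δ S ∩ smp δ S', ∀ y y' : Fin (δ + 1) → ℝ,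
    IsLift δ S x y → IsLift δ S' x y' → lastCoord y ≤ lastCoord y'

open scoped Classical in
/-- The lower triangulation of `C(m, δ)`: the collection of `(δ+1)`-element subsets `F` of
`{1, …, m}` such that `|F|_{δ+1}` is a lower facet of `C(m, δ+1)`. -/
def lowerTriang (m δ : ℕ) : Finset (Finset ℕ) :=
  (Finset.Icc 1 m).powerset.filter (fun F => IsLowerFacet m (δ + 1) F)

open scoped Classical in
/-- The upper triangulation of `C(m, δ)`. -/
def upperTriang (m δ : ℕ) : Finset (Finset ℕ) :=
  (Finset.Icc 1 m).powerset.filter (fun F => IsUpperFacet m (δ + 1) F)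

open scoped Classical in
/-- `L(H)`: the `(δ+1)`-element subsets `G` of `H` with `|G|_{δ+1}` a lower facet of the
simplex `|H|_{δ+1}`. -/
def LH (δ : ℕ) (H : Finset ℕ) : Finset (Finset ℕ) :=
  (H.filter (fun c => IsLowerFacetOfSimplex (δ + 1) H c)).image (fun c => H.erase c)

open scoped Classical in
/-- `U(H)`: the `(δ+1)`-element subsets `G` of `H` with `|G|_{δ+1}` an upper facet of the
simplex `|H|_{δ+1}`. -/
def UH (δ : ℕ) (H : Finset ℕ) : Finset (Finset ℕ) :=
  (H.filter (fun c => IsUpperFacetOfSimplex (δ + 1) H c)).image (fun c => H.erase c)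

/-- The `k`-th moment of the signed weight `f` on the finite set `U`. -/
def wtMoment (U : Finset ℕ) (f : ℕ → ℝ) (k : ℕ) : ℝ := ∑ a ∈ U, f a * (a : ℝ) ^ k

lemma sum_smul_momCurve_apply (δ : ℕ) (U : Finset ℕ) (f : ℕ → ℝ) (i : Fin δ) :
    (∑ a ∈ U, f a • momCurve δ (a : ℝ)) i = wtMoment U f (i.1 + 1) := by
  simp [momCurve, wtMoment]

lemma wtMoment_zero (U : Finset ℕ) (f : ℕ → ℝ) : wtMoment U f 0 = ∑ a ∈ U, f a := by
  simp [wtMoment]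

lemma lastCoord_sum_smul_momCurve (δ : ℕ) (U : Finset ℕ) (f : ℕ → ℝ) :
    lastCoord (∑ a ∈ U, f a • momCurve (δ + 1) (a : ℝ)) = wtMoment U f (δ + 1) := by
  simp only [lastCoord, Nat.zero_lt_succ, dif_pos, sum_smul_momCurve_apply]
  rfl

lemma wtMoment_eq_of_sum_smul_eq {δ : ℕ} {U V : Finset ℕ} {f g : ℕ → ℝ}
    (h0 : ∑ a ∈ U, f a = ∑ a ∈ V, g a)
    (h : ∑ a ∈ U, f a • momCurve δ (a : ℝ) = ∑ a ∈ V, g a • momCurve δ (a : ℝ)) :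
    ∀ k ≤ δ, wtMoment U f k = wtMoment V g k := by
  rintro (_ | k) hk
  · simpa only [wtMoment_zero] using h0
  · simpa only [sum_smul_momCurve_apply] using congrFun h ⟨k, hk⟩

lemma sum_smul_eq_of_wtMoment_eq {δ : ℕ} {U V : Finset ℕ} {f g : ℕ → ℝ}
    (h : ∀ k ≤ δ, wtMoment U f k = wtMoment V g k) :
    ∑ a ∈ U, f a • momCurve δ (a : ℝ) = ∑ a ∈ V, g a • momCurve δ (a : ℝ) := by
  ext i
  simpa only [sum_smul_momCurve_apply] using h _ i.2

lemma sum_mul_eval (U : Finset ℕ) (f : ℕ → ℝ) (P : Polynomial ℝ) {n : ℕ}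
    (hP : P.natDegree < n) :
    ∑ a ∈ U, f a * P.eval (a : ℝ) = ∑ k ∈ Finset.range n, P.coeff k * wtMoment U f k := by
  simp only [wtMoment, Finset.mul_sum, P.eval_eq_sum_range' hP]
  rw [Finset.sum_comm]
  exact Finset.sum_congr rfl fun _ _ => Finset.sum_congr rfl fun _ _ => by ring

lemma sum_mul_eval_eq_zero {δ : ℕ} {U : Finset ℕ} {f : ℕ → ℝ}
    (h : ∀ k ≤ δ, wtMoment U f k = 0) {P : Polynomial ℝ} (hP : P.natDegree ≤ δ) :
    ∑ a ∈ U, f a * P.eval (a : ℝ) = 0 := by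
  rw [sum_mul_eval U f P (Nat.lt_succ_of_le hP)]
  refine Finset.sum_eq_zero fun k hk => ?_
  rw [h k (Nat.lt_succ_iff.mp (Finset.mem_range.mp hk)), mul_zero]

lemma sum_mul_eval_of_monic {δ : ℕ} {U : Finset ℕ} {f : ℕ → ℝ}
    (h : ∀ k ≤ δ, wtMoment U f k = 0) {P : Polynomial ℝ} (hm : P.Monic)
    (hP : P.natDegree = δ + 1) :
    ∑ a ∈ U, f a * P.eval (a : ℝ) = wtMoment U f (δ + 1) := by
  rw [sum_mul_eval U f P (Nat.lt_succ_of_le hP.le), Finset.sum_range_succ,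
    Finset.sum_eq_zero, zero_add, ← hP, hm.coeff_natDegree, one_mul]
  intro k hk
  rw [h k (Nat.lt_succ_iff.mp (Finset.mem_range.mp hk)), mul_zero]

/-- The monic polynomial whose simple roots are the elements of `U`. -/
def rootPoly (U : Finset ℕ) : Polynomial ℝ :=
  ∏ a ∈ U, (Polynomial.X - Polynomial.C (a : ℝ))

lemma rootPoly_monic (U : Finset ℕ) : (rootPoly U).Monic :=
  Polynomial.monic_prod_of_monic _ _ fun _ _ => Polynomial.monic_X_sub_C _

lemma natDegree_rootPoly (U : Finset ℕ) : (rootPoly U).natDegree = U.card := by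
  rw [rootPoly, Polynomial.natDegree_prod_of_monic _ _ fun _ _ => Polynomial.monic_X_sub_C _]
  simp only [Polynomial.natDegree_X_sub_C, Finset.sum_const, smul_eq_mul, mul_one]

lemma eval_rootPoly_eq_zero_iff {U : Finset ℕ} {b : ℕ} :
    (rootPoly U).eval (b : ℝ) = 0 ↔ b ∈ U := by
  simp [rootPoly, Polynomial.eval_prod, Finset.prod_eq_zero_iff, sub_eq_zero]

lemma natDegree_rootPoly_sq (U : Finset ℕ) : (rootPoly U ^ 2).natDegree = 2 * U.card := by
  rw [(rootPoly_monic U).natDegree_pow, natDegree_rootPoly]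

/-- A weight on at most `δ + 1` points with vanishing moments of order at most `δ` is zero. -/
lemma eq_zero_of_wtMoment_eq_zero {δ : ℕ} {U : Finset ℕ} {f : ℕ → ℝ}
    (h : ∀ k ≤ δ, wtMoment U f k = 0) (hU : U.card ≤ δ + 1) : ∀ a ∈ U, f a = 0 := by
  intro a ha
  have hdeg : (rootPoly (U.erase a)).natDegree ≤ δ := by
    rw [natDegree_rootPoly, Finset.card_erase_of_mem ha]; omega
  have hs := sum_mul_eval_eq_zero h hdeg
  rw [Finset.sum_eq_single_of_mem a ha] at hs
  · refine (mul_eq_zero.mp hs).resolve_right fun h0 => ?_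
    exact absurd (eval_rootPoly_eq_zero_iff.mp h0) (Finset.notMem_erase a U)
  · intro b hb hba
    rw [eval_rootPoly_eq_zero_iff.mpr (Finset.mem_erase.mpr ⟨hba, hb⟩), mul_zero]

/-- The positive and negative parts of a weight supported on at most `δ + 2` points, with vanishing
moments of order at most `δ` and positive moment of order `δ + 1`. -/
lemma card_filter_neg {δ : ℕ} {V : Finset ℕ} {g : ℕ → ℝ} (hV : V.card ≤ δ + 2)
    (h0 : ∀ k ≤ δ, wtMoment V g k = 0) (hpos : 0 < wtMoment V g (δ + 1))
    (hg : ∀ a ∈ V, g a ≠ 0) : (V.filter fun a => g a < 0).card = δ / 2 + 1 := by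
  set A := V.filter fun a => 0 < g a with hA
  set B := V.filter fun a => g a < 0 with hB
  have hcard : A.card + B.card = V.card := by
    rw [← Finset.card_union_of_disjoint]
    · congr 1
      ext a
      simp only [hA, hB, Finset.mem_union, Finset.mem_filter]
      refine ⟨fun h => h.elim And.left And.left, fun h => ?_⟩
      rcases lt_or_gt_of_ne (hg a h) with h' | h'
      · exact Or.inr ⟨h, h'⟩
      · exact Or.inl ⟨h, h'⟩
    · rw [Finset.disjoint_left]
      intro a h1 h2
      exact lt_asymm (Finset.mem_filter.mp h1).2 (Finset.mem_filter.mp h2).2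
  have hAne : ∃ a ∈ V, 0 < g a := by
    by_contra! hneg
    have hs := h0 0 (Nat.zero_le _)
    rw [wtMoment_zero, Finset.sum_eq_zero_iff_of_nonpos hneg] at hs
    refine hpos.ne' (Finset.sum_eq_zero fun a ha => ?_)
    rw [hs a ha, zero_mul]
  have hBcard : δ + 1 ≤ 2 * B.card := by
    by_contra! hlt
    have hs := sum_mul_eval_eq_zero h0 (P := rootPoly B ^ 2)
      (by rw [natDegree_rootPoly_sq]; omega)
    have hnn : ∀ a ∈ V, 0 ≤ g a * (rootPoly B ^ 2).eval (a : ℝ) := by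
      intro a ha
      rw [Polynomial.eval_pow]
      rcases lt_or_gt_of_ne (hg a ha) with h' | h'
      · rw [eval_rootPoly_eq_zero_iff.mpr (Finset.mem_filter.mpr ⟨ha, h'⟩)]; simp
      · positivity
    obtain ⟨a, ha, hga⟩ := hAne
    have := (Finset.sum_eq_zero_iff_of_nonneg hnn).mp hs a ha
    rw [Polynomial.eval_pow] at this
    have := eval_rootPoly_eq_zero_iff.mp
      (pow_eq_zero_iff two_ne_zero |>.mp ((mul_eq_zero.mp this).resolve_left hga.ne'))
    exact lt_asymm hga (Finset.mem_filter.mp this).2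
  have hnp : ∀ a ∈ V, g a * (rootPoly A ^ 2).eval (a : ℝ) ≤ 0 := by
    intro a ha
    rw [Polynomial.eval_pow]
    rcases lt_or_gt_of_ne (hg a ha) with h' | h'
    · exact mul_nonpos_of_nonpos_of_nonneg h'.le (sq_nonneg _)
    · rw [eval_rootPoly_eq_zero_iff.mpr (Finset.mem_filter.mpr ⟨ha, h'⟩)]; simp
  have hBne : ∃ a ∈ V, g a < 0 := by
    have : 0 < B.card := by omega
    obtain ⟨a, ha⟩ := Finset.card_pos.mp this
    exact ⟨a, Finset.mem_filter.mp ha⟩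
  have hAcard : δ + 2 ≤ 2 * A.card := by
    by_contra! hlt
    rcases Nat.lt_or_ge δ (2 * A.card) with hd | hd
    · have hs := sum_mul_eval_of_monic h0 ((rootPoly_monic A).pow 2)
        (by rw [natDegree_rootPoly_sq]; omega)
      exact (hs ▸ Finset.sum_nonpos hnp).not_gt hpos
    · have hs := sum_mul_eval_eq_zero h0 (P := rootPoly A ^ 2)
        (by rw [natDegree_rootPoly_sq]; omega)
      obtain ⟨a, ha, hga⟩ := hBne
      have := (Finset.sum_eq_zero_iff_of_nonpos hnp).mp hs a ha
      rw [Polynomial.eval_pow] at this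
      have := eval_rootPoly_eq_zero_iff.mp
        (pow_eq_zero_iff two_ne_zero |>.mp ((mul_eq_zero.mp this).resolve_left hga.ne))
      exact lt_asymm hga (Finset.mem_filter.mp this).2
  omega

lemma exists_ne_zero_wtMoment_eq_zero {U : Finset ℕ} {n : ℕ} (hU : n < U.card) :
    ∃ h : ℕ → ℝ, (∀ k < n, wtMoment U h k = 0) ∧ ∃ a ∈ U, h a ≠ 0 := by
  let F : (U → ℝ) →ₗ[ℝ] (Fin n → ℝ) :=
    (Matrix.of fun (k : Fin n) (a : U) => (a.1 : ℝ) ^ k.1).mulVecLin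
  have hF : LinearMap.ker F ≠ ⊥ := F.ker_ne_bot_of_finrank_lt (by simpa using hU)
  obtain ⟨v, hv, hv0⟩ := (Submodule.ne_bot_iff _).mp hF
  obtain ⟨a, ha⟩ := Function.ne_iff.mp hv0
  refine ⟨fun b => if hb : b ∈ U then v ⟨b, hb⟩ else 0, fun k hk => ?_, a.1, a.2, by simpa using ha⟩
  have := congrFun (LinearMap.mem_ker.mp hv) ⟨k, hk⟩
  simp only [F, Matrix.mulVecLin_apply, Matrix.mulVec, dotProduct, Matrix.of_apply,
    Pi.zero_apply] at this
  rw [wtMoment, ← Finset.sum_coe_sort, ← this]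
  exact Finset.sum_congr rfl fun b _ => by simp [mul_comm]

lemma wtMoment_erase {U : Finset ℕ} {f : ℕ → ℝ} {a : ℕ} (hf : f a = 0) (k : ℕ) :
    wtMoment (U.erase a) f k = wtMoment U f k :=
  Finset.sum_erase _ (by rw [hf, zero_mul])

lemma wtMoment_sub_mul (U : Finset ℕ) (f h : ℕ → ℝ) (c : ℝ) (k : ℕ) :
    wtMoment U (fun a => f a - c * h a) k = wtMoment U f k - c * wtMoment U h k := by
  simp only [wtMoment, Finset.mul_sum, ← Finset.sum_sub_distrib]
  exact Finset.sum_congr rfl fun _ _ => by ring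

/-- Sign-conformal reduction of a weight to a support of at most `δ + 2` points, preserving the
vanishing of the moments of order at most `δ` and the positivity of the moment of order `δ + 1`. -/
lemma exists_conformal (δ : ℕ) (U : Finset ℕ) (f : ℕ → ℝ)
    (h0 : ∀ k ≤ δ, wtMoment U f k = 0) (hpos : 0 < wtMoment U f (δ + 1)) :
    ∃ V ⊆ U, ∃ g : ℕ → ℝ, V.card ≤ δ + 2 ∧ (∀ a ∈ V, 0 < f a * g a) ∧
      (∀ k ≤ δ, wtMoment V g k = 0) ∧ 0 < wtMoment V g (δ + 1) := by
  induction hn : U.card generalizing U f with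
  | zero =>
    rw [Finset.card_eq_zero.mp hn] at hpos
    simp [wtMoment] at hpos
  | succ n ih =>
    by_cases hz : ∃ a ∈ U, f a = 0
    · obtain ⟨a, ha, hfa⟩ := hz
      obtain ⟨V, hV, hg⟩ := ih (U.erase a) f (fun k hk => by rw [wtMoment_erase hfa, h0 k hk])
        (by rwa [wtMoment_erase hfa]) (by rw [Finset.card_erase_of_mem ha, hn]; rfl)
      exact ⟨V, hV.trans (Finset.erase_subset _ _), hg⟩
    push Not at hz
    by_cases hc : U.card ≤ δ + 2
    · exact ⟨U, Finset.Subset.refl _, f, hc, fun a ha => mul_self_pos.mpr (hz a ha), h0, hpos⟩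
    obtain ⟨h, hh, hne⟩ : ∃ h : ℕ → ℝ, (∀ k < δ + 2, wtMoment U h k = 0) ∧
        ∃ a ∈ U, 0 < h a / f a := by
      obtain ⟨h, hh, a, ha, hne⟩ := exists_ne_zero_wtMoment_eq_zero (not_le.mp hc)
      rcases lt_or_gt_of_ne (div_ne_zero hne (hz a ha)) with h' | h'
      · refine ⟨fun b => -h b, fun k hk => ?_, a, ha, ?_⟩
        · have := hh k hk
          simp only [wtMoment, neg_mul, Finset.sum_neg_distrib, neg_eq_zero] at this ⊢
          exact this
        · rw [neg_div]; exact neg_pos.mpr h'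
      · exact ⟨h, hh, a, ha, h'⟩
    obtain ⟨a₀, ha₀, hr₀⟩ := hne
    obtain ⟨b, hb, hmax⟩ := Finset.exists_max_image U (fun a => h a / f a) ⟨a₀, ha₀⟩
    have hr : 0 < h b / f b := hr₀.trans_le (hmax a₀ ha₀)
    have hhb : h b ≠ 0 := fun h' => by simp [h'] at hr
    set g : ℕ → ℝ := fun a => f a - f b / h b * h a with hgdef
    have hgb : g b = 0 := by simp only [hgdef]; field_simp; ring
    have hgm : ∀ k ≤ δ + 1, wtMoment (U.erase b) g k = wtMoment U f k := by
      intro k hk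
      rw [wtMoment_erase hgb, wtMoment_sub_mul, hh k (by omega)]; ring
    have hfac : ∀ a ∈ U, ∃ c : ℝ, 0 ≤ c ∧ g a = f a * c := by
      intro a ha
      refine ⟨1 - (h a / f a) / (h b / f b), ?_, ?_⟩
      · rw [sub_nonneg, div_le_one hr]; exact hmax a ha
      · have := hz a ha
        have := hz b hb
        simp only [hgdef]; field_simp
    obtain ⟨V, hV, g', hc', hg', hm, hp⟩ := ih (U.erase b) g
      (fun k hk => by rw [hgm k (by omega), h0 k hk]) (by rwa [hgm _ le_rfl])
      (by rw [Finset.card_erase_of_mem hb, hn]; rfl)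
    refine ⟨V, hV.trans (Finset.erase_subset _ _), g', hc', fun a ha => ?_, hm, hp⟩
    obtain ⟨c, hc0, hca⟩ := hfac a (Finset.erase_subset _ _ (hV ha))
    have := hg' a ha
    rw [hca, mul_right_comm] at this
    exact pos_of_mul_pos_left this hc0

lemma wtMoment_extend {A S : Finset ℕ} (h : A ⊆ S) (w : ℕ → ℝ) (k : ℕ) :
    wtMoment S (fun a => if a ∈ A then w a else 0) k = wtMoment A w k := by
  simp only [wtMoment, ite_mul, zero_mul, Finset.sum_ite_mem, Finset.inter_eq_right.mpr h]

/-- If one weight on `S` and one on `S'` define the same point, the first having the higher lift,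
then this also happens for some subsets of `S` and `S'`, the second of size `⌊δ/2⌋ + 1`. -/
lemma exists_circuit {δ : ℕ} {S S' : Finset ℕ} {w w' : ℕ → ℝ}
    (hw : ∀ a ∈ S, 0 ≤ w a) (hw' : ∀ a ∈ S', 0 ≤ w' a)
    (h0 : ∀ k ≤ δ, wtMoment S w k = wtMoment S' w' k)
    (hlt : wtMoment S' w' (δ + 1) < wtMoment S w (δ + 1)) :
    ∃ A ⊆ S, ∃ B ⊆ S', ∃ v v' : ℕ → ℝ, B.card = δ / 2 + 1 ∧
      (∀ a ∈ A, 0 ≤ v a) ∧ (∀ a ∈ B, 0 ≤ v' a) ∧ ∑ a ∈ A, v a = 1 ∧ ∑ a ∈ B, v' a = 1 ∧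
      (∀ k ≤ δ, wtMoment A v k = wtMoment B v' k) ∧
      wtMoment B v' (δ + 1) < wtMoment A v (δ + 1) := by
  set f : ℕ → ℝ := fun a => (if a ∈ S then w a else 0) - 1 * (if a ∈ S' then w' a else 0) with hf
  have hfm : ∀ k, wtMoment (S ∪ S') f k = wtMoment S w k - wtMoment S' w' k := by
    intro k
    rw [hf, wtMoment_sub_mul, wtMoment_extend Finset.subset_union_left,
      wtMoment_extend Finset.subset_union_right, one_mul]
  obtain ⟨V, -, g, hV, hfg, hg0, hgpos⟩ := exists_conformal δ (S ∪ S') f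
    (fun k hk => by rw [hfm, h0 k hk, sub_self]) (by rw [hfm]; exact sub_pos.mpr hlt)
  have hgne : ∀ a ∈ V, g a ≠ 0 := fun a ha h => by simpa [h] using hfg a ha
  have hcard := card_filter_neg hV hg0 hgpos hgne
  set A := V.filter fun a => 0 < g a
  set B := V.filter fun a => g a < 0
  have hsplit : ∀ k, wtMoment V g k = wtMoment A g k + wtMoment B g k := by
    intro k
    rw [wtMoment, ← Finset.sum_filter_add_sum_filter_not V (fun a => 0 < g a)]
    refine congrArg₂ _ rfl (Finset.sum_congr (Finset.filter_congr fun a ha => ?_) fun _ _ => rfl)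
    exact ⟨fun h => lt_of_le_of_ne (not_lt.mp h) (hgne a ha), fun h => h.le.not_gt⟩
  have hscale : ∀ (U : Finset ℕ) (c : ℝ) (k : ℕ),
      wtMoment U (fun a => c * g a) k = c * wtMoment U g k := by
    intro U c k
    simp only [wtMoment, Finset.mul_sum, mul_assoc]
  have hBne : B.Nonempty := Finset.card_pos.mp (by omega)
  set c := -wtMoment B g 0 with hc
  have hcpos : 0 < c := by
    rw [hc, wtMoment_zero, neg_pos]
    exact Finset.sum_neg (fun a ha => (Finset.mem_filter.mp ha).2) hBne
  have hAB : ∀ k ≤ δ, wtMoment A g k = -wtMoment B g k := by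
    intro k hk
    have := hsplit k
    rw [hg0 k hk] at this
    linarith
  refine ⟨A, fun a ha => ?_, B, fun a ha => ?_, fun a => c⁻¹ * g a, fun a => -c⁻¹ * g a, hcard,
    fun a ha => ?_, fun a ha => ?_, ?_, ?_, fun k hk => ?_, ?_⟩
  · obtain ⟨ha, hga⟩ := Finset.mem_filter.mp ha
    have hfa := pos_of_mul_pos_left (hfg a ha) hga.le
    by_contra hS
    simp only [hf, hS, if_false] at hfa
    split_ifs at hfa with h
    · linarith [hw' a h]
    · linarith
  · obtain ⟨ha, hga⟩ := Finset.mem_filter.mp ha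
    have hfa : f a < 0 := neg_of_mul_pos_left (hfg a ha) hga.le
    by_contra hS
    simp only [hf, hS, if_false] at hfa
    split_ifs at hfa with h
    · linarith [hw a h]
    · linarith
  · exact mul_nonneg (inv_nonneg.mpr hcpos.le) (Finset.mem_filter.mp ha).2.le
  · exact mul_nonneg_of_nonpos_of_nonpos (neg_nonpos.mpr (inv_nonneg.mpr hcpos.le))
      (Finset.mem_filter.mp ha).2.le
  · rw [← wtMoment_zero, hscale, hAB 0 (Nat.zero_le _), inv_mul_cancel₀ hcpos.ne']
  · rw [← wtMoment_zero, hscale, neg_mul, ← mul_neg, inv_mul_cancel₀ hcpos.ne']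
  · rw [hscale, hscale, hAB k hk]; ring
  · rw [hscale, hscale, neg_mul, ← mul_neg]
    refine mul_lt_mul_of_pos_left ?_ (inv_pos.mpr hcpos)
    linarith [hsplit (δ + 1)]

lemma exists_weights_of_mem_smp {δ : ℕ} {A : Finset ℕ} {x : Fin δ → ℝ} (hx : x ∈ smp δ A) :
    ∃ w : ℕ → ℝ, (∀ a ∈ A, 0 ≤ w a) ∧ ∑ a ∈ A, w a = 1 ∧
      ∑ a ∈ A, w a • momCurve δ (a : ℝ) = x := by
  refine convexHull_min (t := {x | ∃ w : ℕ → ℝ, (∀ a ∈ A, 0 ≤ w a) ∧ ∑ a ∈ A, w a = 1 ∧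
      ∑ a ∈ A, w a • momCurve δ (a : ℝ) = x}) ?_ ?_ hx
  · rintro _ ⟨a, ha, rfl⟩
    have ha : a ∈ A := ha
    refine ⟨fun b => if b = a then 1 else 0, fun b _ => ?_, by simp [ha], by simp [ha]⟩
    dsimp only
    split_ifs <;> norm_num
  · rintro _ ⟨w, hw, hw1, rfl⟩ _ ⟨v, hv, hv1, rfl⟩ s t hs ht hst
    refine ⟨fun a => s * w a + t * v a, fun a ha => ?_, ?_, ?_⟩
    · exact add_nonneg (mul_nonneg hs (hw a ha)) (mul_nonneg ht (hv a ha))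
    · rw [Finset.sum_add_distrib, ← Finset.mul_sum, ← Finset.mul_sum, hw1, hv1]; simpa using hst
    · simp only [add_smul, mul_smul, Finset.sum_add_distrib, Finset.smul_sum]

lemma exists_isLift {δ : ℕ} {A : Finset ℕ} {x : Fin δ → ℝ} (hx : x ∈ smp δ A) :
    ∃ y, IsLift δ A x y := by
  obtain ⟨w, h1, h2, h3⟩ := exists_weights_of_mem_smp hx
  exact ⟨_, w, h1, h2, h3, rfl⟩

lemma IsLift.mem_smp {δ : ℕ} {A : Finset ℕ} {x : Fin δ → ℝ} {y : Fin (δ + 1) → ℝ}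
    (h : IsLift δ A x y) : x ∈ smp δ A := by
  obtain ⟨w, h1, h2, rfl, -⟩ := h
  exact (convex_convexHull ℝ _).sum_mem h1 h2 fun a ha =>
    subset_convexHull ℝ _ (Set.mem_image_of_mem _ ha)

lemma IsLift.mono {δ : ℕ} {A S : Finset ℕ} (hAS : A ⊆ S) {x : Fin δ → ℝ} {y : Fin (δ + 1) → ℝ}
    (h : IsLift δ A x y) : IsLift δ S x y := by
  obtain ⟨w, h1, h2, h3, h4⟩ := h
  refine ⟨fun a => if a ∈ A then w a else 0, fun a _ => ?_, ?_, ?_, ?_⟩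
  · dsimp only
    split_ifs with h
    exacts [h1 a h, le_rfl]
  · rw [← wtMoment_zero, wtMoment_extend hAS, wtMoment_zero, h2]
  · rw [← h3]
    exact sum_smul_eq_of_wtMoment_eq fun k _ => wtMoment_extend hAS w k
  · rw [← h4]
    exact sum_smul_eq_of_wtMoment_eq fun k _ => wtMoment_extend hAS w k

lemma IsLift.unique {δ : ℕ} {S : Finset ℕ} (hS : S.card ≤ δ + 1) {x : Fin δ → ℝ}
    {y y' : Fin (δ + 1) → ℝ} (h : IsLift δ S x y) (h' : IsLift δ S x y') : y = y' := by
  obtain ⟨w, -, h2, h3, rfl⟩ := h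
  obtain ⟨w', -, h2', h3', rfl⟩ := h'
  have hm := wtMoment_eq_of_sum_smul_eq (h2.trans h2'.symm) (h3.trans h3'.symm)
  have hz := eq_zero_of_wtMoment_eq_zero (δ := δ) (f := fun a => w a - 1 * w' a)
    (fun k hk => by rw [wtMoment_sub_mul, hm k hk]; ring) hS
  refine Finset.sum_congr rfl fun a ha => ?_
  have := hz a ha
  rw [one_mul, sub_eq_zero] at this
  rw [this]

lemma smp_mono {δ : ℕ} {A B : Finset ℕ} (h : A ⊆ B) : smp δ A ⊆ smp δ B :=
  convexHull_mono (Set.image_mono (by exact_mod_cast h))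

/-- Lifts through a face of a triangulation agree with lifts through its simplices. -/
lemma IsTriangulation.isLift_unique {m δ : ℕ} {T : Finset (Finset ℕ)} (hT : IsTriangulation m δ T)
    {S S' : Finset ℕ} (hS : S ∈ T) (hS' : S' ∈ T) {x : Fin δ → ℝ} {y y' : Fin (δ + 1) → ℝ}
    (h : IsLift δ S x y) (h' : IsLift δ S' x y') : y = y' := by
  have hx : x ∈ smp δ (S ∩ S') := hT.2.2 S hS S' hS' ▸ ⟨h.mem_smp, h'.mem_smp⟩
  obtain ⟨z, hz⟩ := exists_isLift hx
  exact (h.unique (hT.1 S hS).2.le (hz.mono Finset.inter_subset_left)).trans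
    ((hz.mono Finset.inter_subset_right).unique (hT.1 S' hS').2.le h')

lemma IsTriangulation.supermerged_of_isFace {m δ : ℕ} {T : Finset (Finset ℕ)}
    (hT : IsTriangulation m δ T) {A : Finset ℕ} (hA : IsFace T A) : Supermerged δ T A := by
  obtain ⟨S, hS, hAS⟩ := hA
  intro S' hS' x _ y y' hy hy'
  rw [hT.isLift_unique hS hS' (hy.mono hAS) hy']

/-- `T ≤₂ T'` iff every `(⌊δ/2⌋+1)`-element subset of `{1, …, m}` whose
simplex is supermerged by `T'` is also supermerged by `T`. -/
theorem statement13 (δ m : ℕ) (hδ : 1 ≤ δ) (hm : δ + 1 ≤ m)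
    (T T' : Finset (Finset ℕ))
    (hT : IsTriangulation m δ T) (hT' : IsTriangulation m δ T') :
    HST2 δ T T' ↔
      ∀ A : Finset ℕ, A ⊆ Finset.Icc 1 m → A.card = δ / 2 + 1 →
        Supermerged δ T' A → Supermerged δ T A := by
  constructor
  · intro h A hA _ hsup S hS x hx y y' hy hy'
    have hxc : x ∈ ⋃ S ∈ T', smp δ S := hT'.2.1 ▸ smp_mono hA hx.1
    simp only [Set.mem_iUnion] at hxc
    obtain ⟨S', hS', hxS'⟩ := hxc
    obtain ⟨z, hz⟩ := exists_isLift hxS'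
    exact (h S hS S' hS' x ⟨hx.2, hxS'⟩ y' z hy' hz).trans
      (hsup S' hS' x ⟨hx.1, hxS'⟩ y z hy hz)
  · intro h S hS S' hS' x _ y y' ⟨w, hw, hw1, hwx, hwy⟩ ⟨w', hw', hw1', hwx', hwy'⟩
    by_contra! hlt
    rw [← hwy, ← hwy', lastCoord_sum_smul_momCurve, lastCoord_sum_smul_momCurve] at hlt
    obtain ⟨A, hA, B, hB, v, v', hcard, hv, hv', hv1, hv1', hm, hlt⟩ := exists_circuit hw hw'
      (wtMoment_eq_of_sum_smul_eq (hw1.trans hw1'.symm) (hwx.trans hwx'.symm)) hlt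
    have hliftA : IsLift δ A _ _ := ⟨v, hv, hv1, rfl, rfl⟩
    have hliftB : IsLift δ B _ _ := ⟨v', hv', hv1', (sum_smul_eq_of_wtMoment_eq hm).symm, rfl⟩
    have hle := h B (hB.trans (hT'.1 S' hS').1) hcard
      (hT'.supermerged_of_isFace ⟨S', hS', hB⟩) S hS _
      ⟨hliftB.mem_smp, smp_mono hA hliftA.mem_smp⟩ _ _ hliftB (hliftA.mono hA)
    rw [lastCoord_sum_smul_momCurve, lastCoord_sum_smul_momCurve] at hle
    exact hle.not_gt hlt
end
end

section
/- Let d ≥ 0 and m ≥ 2d+3 be integers. For every (d+1)-element subset A of {1, …, m} there exists a (2d+2)-element subset F of {1, …, m} with A ⊆ F such that |F|_{2d+2} is a lower facet of the cyclic polytope C(m, 2d+2). That is, every d-simplex spanned by vertices of C(m, 2d+2) lies in a lower facet. -/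
open Finset

noncomputable section

theorem eval_eq_sum_eval_basis {K ι : Type*} [Field K] [DecidableEq ι] {s : Finset ι} {v : ι → K}
    (hv : Set.InjOn v s) {p : Polynomial K} (hp : p.degree < #s) (x : K) :
    p.eval x = ∑ i ∈ s, (Lagrange.basis s v i).eval x * p.eval (v i) := by
  conv_lhs => rw [Lagrange.eq_interpolate hv hp, Lagrange.interpolate_apply]
  simp [Polynomial.eval_finsetSum, mul_comm]

theorem sum_smul_mem_affineSpan_image {V ι : Type*} [AddCommGroup V] [Module ℝ V]
    (s : Finset ι) (p : ι → V) (w : ι → ℝ) (hw : ∑ i ∈ s, w i = 1) :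
    ∑ i ∈ s, w i • p i ∈ affineSpan ℝ (p '' s) := by
  rw [← s.affineCombination_eq_linear_combination p w hw]
  exact affineCombination_mem_affineSpan_image hw (fun i hi hi' => absurd hi hi') p

/-- The hyperplane through the `δ` points of the moment curve indexed by `F` is the graph along
`e_δ` whose vertical distance to the curve is the nodal polynomial of `F`. -/
theorem momCurve_sub_prod_smul_mem {δ : ℕ} (hδ : 0 < δ) {F : Finset ℕ} (hF : #F = δ) (x : ℝ) :
    momCurve δ x - (∏ f ∈ F, (x - (f : ℝ))) • eLast δ ∈ affineSpan ℝ (momPts δ F) := by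
  have hv : Set.InjOn (fun n : ℕ => (n : ℝ)) F := Nat.cast_injective.injOn
  set w : ℕ → ℝ := fun f => (Lagrange.basis F (fun n : ℕ => (n : ℝ)) f).eval x
  have hsum : ∑ f ∈ F, w f = 1 := by
    have h := eval_eq_sum_eval_basis hv (p := 1)
      (by rw [Polynomial.degree_one, hF]; exact_mod_cast hδ) x
    simpa using h.symm
  have hpow : ∀ k < δ, x ^ k = ∑ f ∈ F, w f * (f : ℝ) ^ k := fun k hk => by
    have h := eval_eq_sum_eval_basis hv (p := Polynomial.X ^ k)
      (by rw [Polynomial.degree_X_pow, hF]; exact_mod_cast hk) x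
    simpa using h
  have htop : x ^ δ - ∏ f ∈ F, (x - (f : ℝ)) = ∑ f ∈ F, w f * (f : ℝ) ^ δ := by
    have hdeg : (Polynomial.X ^ δ - Lagrange.nodal F (fun n : ℕ => (n : ℝ))).degree
        < (#F : WithBot ℕ) := by
      have h := Polynomial.degree_sub_lt_left
        (p := Polynomial.X ^ δ) (q := Lagrange.nodal F (fun n : ℕ => (n : ℝ)))
        (by rw [Polynomial.degree_X_pow, Lagrange.degree_nodal, hF])
        (Polynomial.monic_X_pow δ).ne_zero
        (by rw [(Polynomial.monic_X_pow δ).leadingCoeff, Lagrange.nodal_monic.leadingCoeff])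
      rwa [Polynomial.degree_X_pow, ← congrArg (Nat.cast (R := WithBot ℕ)) hF] at h
    have h := eval_eq_sum_eval_basis hv hdeg x
    rw [Polynomial.eval_sub, Polynomial.eval_pow, Polynomial.eval_X, Lagrange.eval_nodal] at h
    rw [h]
    refine sum_congr rfl fun f hf => ?_
    rw [Polynomial.eval_sub, Lagrange.eval_nodal_at_node hf]
    simp [w]
  have hcomb : momCurve δ x - (∏ f ∈ F, (x - (f : ℝ))) • eLast δ
      = ∑ f ∈ F, w f • momCurve δ (f : ℝ) := by
    funext i
    simp only [Pi.sub_apply, Pi.smul_apply, Finset.sum_apply, smul_eq_mul, momCurve, eLast]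
    have hi := i.2
    by_cases h : i.1 = δ - 1
    · rw [if_pos h, mul_one, show i.1 + 1 = δ by omega, htop]
    · rw [if_neg h, mul_zero, sub_zero, hpow _ (by omega)]
  rw [hcomb]
  exact sum_smul_mem_affineSpan_image F (fun a : ℕ => momCurve δ (a : ℝ)) w hsum

/-- The lower half of Gale's evenness criterion. -/
theorem isLowerFacet_of_prod_pos {m δ : ℕ} (hδ : 0 < δ) {F : Finset ℕ} (hFm : F ⊆ Icc 1 m)
    (hF : #F = δ) (hpos : ∀ i ∈ Icc 1 m, i ∉ F → 0 < ∏ f ∈ F, ((i : ℝ) - (f : ℝ))) :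
    IsLowerFacet m δ F :=
  ⟨hFm, hF, fun i hi hiF => ⟨_, hpos i hi hiF, momCurve_sub_prod_smul_mem hδ hF i⟩⟩

theorem exists_superset_card_two_mul_prod_pos (m k : ℕ) (hk : 2 * k ≤ m) (A : Finset ℕ)
    (hA : A ⊆ Icc 1 m) (hAk : #A ≤ k) :
    ∃ F : Finset ℕ, A ⊆ F ∧ F ⊆ Icc 1 m ∧ #F = 2 * k ∧
      ∀ i ∈ Icc 1 m, i ∉ F → 0 < ∏ f ∈ F, ((i : ℝ) - (f : ℝ)) := by
  induction m using Nat.strong_induction_on generalizing k A with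
  | _ m ih =>
  rcases hk.eq_or_lt with rfl | hlt
  · exact ⟨Icc 1 (2 * k), hA, Subset.rfl, by simp, fun i hi hi' => absurd hi hi'⟩
  by_cases hmA : m ∈ A
  · have hk1 : 1 ≤ k := (card_pos.2 ⟨m, hmA⟩).trans_le hAk
    obtain ⟨F, hAF, hFm, hFc, hF⟩ := ih (m - 2) (by omega) (k - 1) (by omega)
      ((A.erase m).erase (m - 1))
      (fun a ha => by
        simp only [mem_erase] at ha
        have := mem_Icc.1 (hA ha.2.2)
        exact mem_Icc.2 ⟨this.1, by omega⟩)
      (by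
        have h1 := card_erase_of_mem hmA
        have h2 := card_le_card (erase_subset (m - 1) (A.erase m))
        omega)
    have hlt' : ∀ f ∈ F, f ≤ m - 2 := fun f hf => (mem_Icc.1 (hFm hf)).2
    have hm1 : m - 1 ∉ F := fun h => by have := hlt' _ h; omega
    have hm0 : m ∉ insert (m - 1) F := fun h => by
      rcases mem_insert.1 h with h | h
      · omega
      · have := hlt' _ h; omega
    refine ⟨insert m (insert (m - 1) F), fun a ha => ?_, fun a ha => ?_, ?_, fun i hi hiF => ?_⟩
    · by_cases h0 : a = m
      · simp [h0]
      by_cases h1 : a = m - 1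
      · simp [h1]
      exact mem_insert_of_mem (mem_insert_of_mem (hAF (by simp [h0, h1, ha])))
    · simp only [mem_insert] at ha
      rcases ha with rfl | rfl | ha
      · exact mem_Icc.2 (by omega)
      · exact mem_Icc.2 (by omega)
      · have := mem_Icc.1 (hFm ha)
        exact mem_Icc.2 (by omega)
    · rw [card_insert_of_notMem hm0, card_insert_of_notMem hm1, hFc]
      omega
    · simp only [mem_insert, not_or] at hiF
      have hi' := mem_Icc.1 hi
      rw [prod_insert hm0, prod_insert hm1, ← mul_assoc]
      refine mul_pos (mul_pos_of_neg_of_neg ?_ ?_) (hF i (mem_Icc.2 (by omega)) hiF.2.2)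
      · exact sub_neg.2 (Nat.cast_lt.2 (by omega))
      · exact sub_neg.2 (Nat.cast_lt.2 (by omega))
  · obtain ⟨F, hAF, hFm, hFc, hF⟩ := ih (m - 1) (by omega) k (by omega) A
      (fun a ha => by
        have := mem_Icc.1 (hA ha)
        have hne : a ≠ m := fun h => hmA (h ▸ ha)
        exact mem_Icc.2 (by omega)) hAk
    refine ⟨F, hAF, hFm.trans (Icc_subset_Icc_right (by omega)), hFc, fun i hi hiF => ?_⟩
    have hi' := mem_Icc.1 hi
    by_cases him : i = m
    · refine prod_pos fun f hf => sub_pos.2 (Nat.cast_lt.2 ?_)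
      have := mem_Icc.1 (hFm hf)
      omega
    · exact hF i (mem_Icc.2 (by omega)) hiF

/-- every `d`-simplex spanned by vertices of `C(m, 2d+2)` lies in a lower
facet of `C(m, 2d+2)`. -/
theorem statement17 (d m : ℕ) (hm : 2 * d + 3 ≤ m)
    (A : Finset ℕ) (hA : A ⊆ Finset.Icc 1 m) (hAc : A.card = d + 1) :
    ∃ F : Finset ℕ, A ⊆ F ∧ IsLowerFacet m (2 * d + 2) F := by
  obtain ⟨F, hAF, hFm, hFc, hF⟩ :=
    exists_superset_card_two_mul_prod_pos m (d + 1) (by omega) A hA hAc.le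
  exact ⟨F, hAF, isLowerFacet_of_prod_pos (by omega) hFm hFc hF⟩
end
end
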